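/- arXiv:2403.07497 — 2 statements merged into one kernel-verified Lean document; each statement's English description precedes it below -/
import Mathlib

section
/- Let G be a countable discrete amenable group, (Ω,𝓕,ℙ,G) a measure-preserving dynamical system, and F a continuous bundle random dynamical system over it on a compact metric space (X,d). Then for every pair of points x,y ∈ X one has D^{(r)}(x,y) = D̄^{(r)}(x,y); that is, the Weyl pseudometric of the RDS coincides with its Banach pseudometric. -/
open Filter MeasureTheory Topology Metric Set ENNReal
open scoped symmDiff Classical

/-- `Φ` is a (left) Følner sequence of nonempty finite subsets of `G`. -/
def IsFolner {G : Type*} [Group G] (Φ : ℕ → Finset G) : Prop :=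
  (∀ n, (Φ n).Nonempty) ∧
    ∀ g : G,
      Tendsto (fun n => ((((Φ n).image fun t => g * t) ∆ Φ n).card : ℝ) / ((Φ n).card : ℝ))
        atTop (𝓝 0)

/-- The upper Banach density `BD*(E)` of a subset `E` of an amenable group `G`. -/
noncomputable def upperBanachDensity {G : Type*} [Group G] (E : Set G) : ℝ≥0∞ :=
  ⨆ (Φ : ℕ → Finset G) (_ : IsFolner Φ),
    Filter.limsup
      (fun n => (((Φ n).filter fun g => g ∈ E).card : ℝ≥0∞) / ((Φ n).card : ℝ≥0∞)) atTop

/-- A continuous bundle random dynamical system over the measure-preserving dynamical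
system given by the measure-preserving action of `G` on the probability space `(Ω, μ)`,
with fibers `E ω ⊆ X` and fiber maps `F g ω : E ω → E (g • ω)`. -/
structure RDS (G : Type*) [Group G] (Ω : Type*) [MeasurableSpace Ω] [MulAction G Ω]
    (μ : Measure Ω) (X : Type*) [MetricSpace X] [MeasurableSpace X] [BorelSpace X] where
  E : Ω → Set X
  F : G → Ω → X → X
  measurePreserving_smul : ∀ g : G, MeasurePreserving (fun ω : Ω => g • ω) μ μ
  measurableSet_carrier : MeasurableSet {p : Ω × X | p.2 ∈ E p.1}
  mapsTo : ∀ (g : G) (ω : Ω), Set.MapsTo (F g ω) (E ω) (E (g • ω))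
  one_apply : ∀ (ω : Ω), ∀ x ∈ E ω, F 1 ω x = x
  measurable_F : ∀ g : G, Measurable fun p : {p : Ω × X // p.2 ∈ E p.1} => F g p.1.1 p.1.2
  cocycle : ∀ (g₁ g₂ : G) (ω : Ω), ∀ x ∈ E ω, F g₂ (g₁ • ω) (F g₁ ω x) = F (g₂ * g₁) ω x
  ae_fiber : ∀ᵐ ω ∂μ, (E ω).Nonempty ∧ IsCompact (E ω) ∧ ∀ g : G, ContinuousOn (F g ω) (E ω)

namespace RDS

variable {G : Type*} [Group G] {Ω : Type*} [MeasurableSpace Ω] [MulAction G Ω]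
  {μ : Measure Ω} {X : Type*} [MetricSpace X] [MeasurableSpace X] [BorelSpace X]
  (S : RDS G Ω μ X)

/-- The carrier `𝓔 ⊆ Ω × X` of the RDS. -/
def carrier : Set (Ω × X) := {p : Ω × X | p.2 ∈ S.E p.1}

/-- `d̃(tx, ty) := sup_ω d(F_{t,ω} x, F_{t,ω} y)` when `x, y` lie in a common fiber,
and `∞` otherwise. -/
noncomputable def dt (t : G) (x y : X) : ℝ≥0∞ :=
  if ∃ ω : Ω, x ∈ S.E ω ∧ y ∈ S.E ω then
    ⨆ ω ∈ {ω : Ω | x ∈ S.E ω ∧ y ∈ S.E ω}, edist (S.F t ω x) (S.F t ω y)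
  else ⊤

/-- `D^{(r)}_𝓕(x,y) := limsup_n (1/|Φ n|) Σ_{t ∈ Φ n} d̃(tx,ty)`. -/
noncomputable def DFol (Φ : ℕ → Finset G) (x y : X) : ℝ≥0∞ :=
  Filter.limsup (fun n => (∑ t ∈ Φ n, S.dt t x y) / ((Φ n).card : ℝ≥0∞)) atTop

/-- The Weyl pseudometric `D^{(r)}(x,y)`, the sup over all Følner sequences. -/
noncomputable def DW (x y : X) : ℝ≥0∞ :=
  ⨆ (Φ : ℕ → Finset G) (_ : IsFolner Φ), S.DFol Φ x y

/-- The Banach pseudometric `D̄^{(r)}(x,y) := inf_K sup_g (1/|K|) Σ_{t ∈ Kg} d̃(tx,ty)`. -/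
noncomputable def DB (x y : X) : ℝ≥0∞ :=
  ⨅ (K : Finset G) (_ : K.Nonempty),
    ⨆ g : G, (∑ t ∈ K.image fun k => k * g, S.dt t x y) / ((K.card : ℝ≥0∞))

/-- Weyl-mean equicontinuity of the RDS. -/
def WME : Prop :=
  ∀ ε : ℝ, 0 < ε → ∃ δ : ℝ, 0 < δ ∧ ∀ (ω : Ω) (x y : X),
    x ∈ S.E ω → y ∈ S.E ω → dist x y < δ → S.DW x y < ENNReal.ofReal ε

/-- Banach-mean equicontinuity of the RDS. -/
def BME : Prop :=
  ∀ ε : ℝ, 0 < ε → ∃ δ : ℝ, 0 < δ ∧ ∀ (ω : Ω) (x y : X),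
    x ∈ S.E ω → y ∈ S.E ω → dist x y < δ → S.DB x y < ENNReal.ofReal ε

/-- Mean-L-stability: points starting close stay `ε`-close outside a set of
upper Banach density less than `ε`. -/
def MeanLStable : Prop :=
  ∀ ε : ℝ, 0 < ε → ∃ δ : ℝ, 0 < δ ∧ ∀ (ω : Ω) (x y : X),
    x ∈ S.E ω → y ∈ S.E ω → dist x y < δ →
      upperBanachDensity {g : G | ENNReal.ofReal ε ≤ S.dt g x y} < ENNReal.ofReal ε

/-- `Ĥ^{(r)}_{𝓕,ω}(x,y)`. -/
noncomputable def HFol (Φ : ℕ → Finset G) (ω : Ω) (x y : X) : ℝ≥0∞ :=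
  if x ∈ S.E ω ∧ y ∈ S.E ω then
    Filter.limsup
      (fun n => (∑ t ∈ Φ n, edist (S.F t ω x) (S.F t ω y)) / ((Φ n).card : ℝ≥0∞)) atTop
  else ⊤

/-- `Ĥ^{(r)}_ω(x,y)`, the sup over all Følner sequences of `Ĥ^{(r)}_{𝓕,ω}(x,y)`. -/
noncomputable def HW (ω : Ω) (x y : X) : ℝ≥0∞ :=
  ⨆ (Φ : ℕ → Finset G) (_ : IsFolner Φ), S.HFol Φ ω x y

/-- `Ĥ^{(r)}(x,y) := sup_ω Ĥ^{(r)}_ω(x,y)`. -/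
noncomputable def Hsup (x y : X) : ℝ≥0∞ := ⨆ ω : Ω, S.HW ω x y

/-- Weyl-mean sensitivity of the RDS. -/
def WeylMeanSensitive : Prop :=
  ∃ δ : ℝ, 0 < δ ∧ ∀ (x : X) (ε : ℝ), 0 < ε →
    ∃ (ω : Ω) (y : X), y ∈ S.E ω ∩ Metric.ball x ε ∧ ENNReal.ofReal δ < S.HW ω x y

/-- The set `𝔼_{ω,ε}` of points of `E ω` around which the Weyl pseudometric is
uniformly `< ε` on a small relative ball. -/
def EE (ω : Ω) (ε : ℝ) : Set X :=
  {x ∈ S.E ω | ∃ δ : ℝ, 0 < δ ∧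
    ∀ y ∈ Metric.ball x δ ∩ S.E ω, ∀ z ∈ Metric.ball x δ ∩ S.E ω,
      S.DW y z < ENNReal.ofReal ε}

/-- The set `𝔼` of Weyl-mean equicontinuous points of the RDS. -/
def meanEqPts : Set X :=
  {x : X | ∀ ε : ℝ, 0 < ε → ∃ δ : ℝ, 0 < δ ∧ ∀ (ω : Ω) (y : X),
    y ∈ S.E ω → dist x y < δ → S.DW x y < ENNReal.ofReal ε}

end RDS

/-- `D_𝓕(x,y)` for a (deterministic) group action `T` of `G` on `K`. -/
noncomputable def actDFol {G K : Type*} [Group G] [PseudoMetricSpace K]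
    (T : G → K → K) (Φ : ℕ → Finset G) (x y : K) : ℝ≥0∞ :=
  Filter.limsup (fun n => (∑ t ∈ Φ n, edist (T t x) (T t y)) / ((Φ n).card : ℝ≥0∞)) atTop

/-- The Weyl pseudometric `D(x,y)` for a group action. -/
noncomputable def actDW {G K : Type*} [Group G] [PseudoMetricSpace K]
    (T : G → K → K) (x y : K) : ℝ≥0∞ :=
  ⨆ (Φ : ℕ → Finset G) (_ : IsFolner Φ), actDFol T Φ x y

/-- The Banach pseudometric `D̄(x,y)` for a group action. -/
noncomputable def actDB {G K : Type*} [Group G] [PseudoMetricSpace K]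
    (T : G → K → K) (x y : K) : ℝ≥0∞ :=
  ⨅ (F : Finset G) (_ : F.Nonempty),
    ⨆ g : G, (∑ t ∈ F.image fun k => k * g, edist (T t x) (T t y)) / ((F.card : ℝ≥0∞))

/-- The set of Weyl-mean equicontinuous points of a group action. -/
def actMeanEqPts {G K : Type*} [Group G] [PseudoMetricSpace K]
    (T : G → K → K) : Set K :=
  {x : K | ∀ ε : ℝ, 0 < ε → ∃ δ : ℝ, 0 < δ ∧
    ∀ y : K, dist x y < δ → actDW T x y < ENNReal.ofReal ε}

/-- Right translates of the members of a left Følner sequence form a left Følner sequence. -/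
theorem IsFolner.image_mul_right {G : Type*} [Group G] {Φ : ℕ → Finset G} (hΦ : IsFolner Φ)
    (g : ℕ → G) : IsFolner fun n => (Φ n).image fun k => k * g n := by
  refine ⟨fun n => (hΦ.1 n).image _, fun a => ?_⟩
  refine (hΦ.2 a).congr fun n => ?_
  have hinj : Function.Injective fun k : G => k * g n := mul_left_injective (g n)
  have himage : (((Φ n).image fun k => k * g n).image fun t => a * t)
      = ((Φ n).image fun t => a * t).image fun k => k * g n := by
    simp only [Finset.image_image, Function.comp_def, mul_assoc]
  rw [himage, ← Finset.image_symmDiff _ _ hinj, Finset.card_image_of_injective _ hinj,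
    Finset.card_image_of_injective _ hinj]

theorem sum_le_sum_mul_left_add {G : Type*} [Group G] {f : G → ℝ≥0∞} {M : ℝ≥0∞}
    (hf : ∀ t, f t ≤ M) (A : Finset G) (k : G) :
    ∑ t ∈ A, f t ≤ ∑ t ∈ A, f (k * t) + M * (((A.image fun t => k * t) ∆ A).card : ℝ≥0∞) := by
  have himage : ∑ t ∈ A, f (k * t) = ∑ t ∈ A.image (fun t => k * t), f t :=
    (Finset.sum_image fun a _ b _ h => mul_left_cancel h).symm
  rw [himage]
  set B := A.image fun t => k * t
  calc ∑ t ∈ A, f t ≤ ∑ t ∈ B ∪ B ∆ A, f t := by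
        refine Finset.sum_le_sum_of_subset fun t ht => ?_
        by_cases hB : t ∈ B <;> simp [Finset.mem_symmDiff, ht, hB]
    _ ≤ ∑ t ∈ B, f t + ∑ t ∈ B ∆ A, f t := by
        rw [← Finset.sum_union_inter]
        exact le_self_add
    _ ≤ ∑ t ∈ B, f t + M * ((B ∆ A).card : ℝ≥0∞) := by
        gcongr
        refine (Finset.sum_le_card_nsmul _ _ M fun t _ => hf t).trans_eq ?_
        rw [nsmul_eq_mul, mul_comm]

/-- Averaging over `K` compares Følner averages with averages over translates of `K`. -/
theorem sum_div_card_le_add {G : Type*} [Group G] {f : G → ℝ≥0∞} {M : ℝ≥0∞}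
    (hf : ∀ t, f t ≤ M) {A K : Finset G} (hA : A.Nonempty) (hK : K.Nonempty) :
    (∑ t ∈ A, f t) / (A.card : ℝ≥0∞) ≤
      (⨆ g : G, (∑ t ∈ K.image fun k => k * g, f t) / (K.card : ℝ≥0∞)) +
        M * ∑ k ∈ K, (((A.image fun t => k * t) ∆ A).card : ℝ≥0∞) / (A.card : ℝ≥0∞) := by
  set C := ⨆ g : G, (∑ t ∈ K.image fun k => k * g, f t) / (K.card : ℝ≥0∞)
  have hA0 : (A.card : ℝ≥0∞) ≠ 0 := by simpa using hA.ne_empty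
  have hK0 : (K.card : ℝ≥0∞) ≠ 0 := by simpa using hK.ne_empty
  have hK1 : (1 : ℝ≥0∞) ≤ K.card := by exact_mod_cast hK.card_pos
  have hsum (t : G) : ∑ k ∈ K, f (k * t) ≤ C * K.card := by
    rw [← ENNReal.div_le_iff hK0 (by simp)]
    refine le_trans ?_ (le_iSup _ t)
    rw [Finset.sum_image fun a _ b _ h => mul_right_cancel h]
  set R : ℝ≥0∞ := ∑ k ∈ K, (((A.image fun t => k * t) ∆ A).card : ℝ≥0∞)
  have hmain : (∑ t ∈ A, f t) * K.card ≤ (C * A.card + M * R) * K.card := by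
    calc (∑ t ∈ A, f t) * K.card = ∑ k ∈ K, ∑ t ∈ A, f t := by
          rw [Finset.sum_const, nsmul_eq_mul, mul_comm]
      _ ≤ ∑ k ∈ K, (∑ t ∈ A, f (k * t)
            + M * (((A.image fun t => k * t) ∆ A).card : ℝ≥0∞)) :=
          Finset.sum_le_sum fun k _ => sum_le_sum_mul_left_add hf A k
      _ = ∑ t ∈ A, ∑ k ∈ K, f (k * t) + M * R := by
          rw [Finset.sum_add_distrib, Finset.sum_comm, Finset.mul_sum]
      _ ≤ ∑ _t ∈ A, C * K.card + M * R := by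
          gcongr with t
          exact hsum t
      _ ≤ C * A.card * K.card + M * R * K.card := by
          refine add_le_add ?_ (le_mul_of_one_le_right' hK1)
          rw [Finset.sum_const, nsmul_eq_mul]
          exact (by ring : (A.card : ℝ≥0∞) * (C * K.card) = C * A.card * K.card).le
      _ = (C * A.card + M * R) * K.card := by ring
  have hle : ∑ t ∈ A, f t ≤ C * A.card + M * R :=
    (ENNReal.mul_le_mul_iff_left hK0 (by simp)).1 hmain
  calc (∑ t ∈ A, f t) / (A.card : ℝ≥0∞) ≤ (C * A.card + M * R) / A.card := by gcongr
    _ = C + M * ∑ k ∈ K, (((A.image fun t => k * t) ∆ A).card : ℝ≥0∞) / (A.card : ℝ≥0∞) := by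
      rw [ENNReal.add_div, ENNReal.mul_div_cancel_right hA0 (by simp), mul_div_assoc]
      simp only [R, div_eq_mul_inv, Finset.sum_mul]

theorem IsFolner.tendsto_ennreal {G : Type*} [Group G] {Φ : ℕ → Finset G} (hΦ : IsFolner Φ)
    (k : G) :
    Tendsto (fun n => ((((Φ n).image fun t => k * t) ∆ Φ n).card : ℝ≥0∞) / ((Φ n).card : ℝ≥0∞))
      atTop (𝓝 0) := by
  have h := ENNReal.tendsto_ofReal (hΦ.2 k)
  rw [ENNReal.ofReal_zero] at h
  refine h.congr fun n => ?_
  rw [ENNReal.ofReal_div_of_pos (by exact_mod_cast (hΦ.1 n).card_pos), ENNReal.ofReal_natCast,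
    ENNReal.ofReal_natCast]

theorem limsup_sum_div_card_le {G : Type*} [Group G] {f : G → ℝ≥0∞} {M : ℝ≥0∞} (hM : M ≠ ⊤)
    (hf : ∀ t, f t ≤ M) {Φ : ℕ → Finset G} (hΦ : IsFolner Φ) {K : Finset G} (hK : K.Nonempty) :
    limsup (fun n => (∑ t ∈ Φ n, f t) / ((Φ n).card : ℝ≥0∞)) atTop ≤
      ⨆ g : G, (∑ t ∈ K.image fun k => k * g, f t) / (K.card : ℝ≥0∞) := by
  set C := ⨆ g : G, (∑ t ∈ K.image fun k => k * g, f t) / (K.card : ℝ≥0∞)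
  have hR := tendsto_finsetSum K fun k _ => hΦ.tendsto_ennreal k
  have hlim := (ENNReal.Tendsto.const_mul hR (Or.inr hM)).const_add C
  rw [Finset.sum_const_zero, mul_zero, add_zero] at hlim
  exact (limsup_le_limsup (Eventually.of_forall fun n =>
    sum_div_card_le_add hf (hΦ.1 n) hK)).trans_eq hlim.limsup_eq

theorem iInf_iSup_sum_div_card_le {G : Type*} [Group G] (hG : ∃ Φ : ℕ → Finset G, IsFolner Φ)
    (f : G → ℝ≥0∞) :
    ⨅ (K : Finset G) (_ : K.Nonempty),
        ⨆ g : G, (∑ t ∈ K.image fun k => k * g, f t) / (K.card : ℝ≥0∞) ≤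
      ⨆ (Φ : ℕ → Finset G) (_ : IsFolner Φ),
        limsup (fun n => (∑ t ∈ Φ n, f t) / ((Φ n).card : ℝ≥0∞)) atTop := by
  obtain ⟨Φ, hΦ⟩ := hG
  refine le_of_forall_lt fun c hc => ?_
  obtain ⟨c', hcc', hc'⟩ := exists_between hc
  have hex (n : ℕ) : ∃ g : G,
      c' < (∑ t ∈ (Φ n).image fun k => k * g, f t) / ((Φ n).card : ℝ≥0∞) :=
    lt_iSup_iff.1 (hc'.trans_le (iInf₂_le (Φ n) (hΦ.1 n)))
  choose g hg using hex
  refine hcc'.trans_le (le_iSup₂_of_le _ (hΦ.image_mul_right g) ?_)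
  refine le_limsup_of_frequently_le (Frequently.of_forall fun n => ?_)
  rw [Finset.card_image_of_injective _ (mul_left_injective (g n))]
  exact (hg n).le

theorem RDS.dt_le_ediam {G : Type*} [Group G] {Ω : Type*} [MeasurableSpace Ω] [MulAction G Ω]
    {μ : Measure Ω} {X : Type*} [MetricSpace X] [MeasurableSpace X] [BorelSpace X]
    (S : RDS G Ω μ X) {x y : X} (h : ∃ ω : Ω, x ∈ S.E ω ∧ y ∈ S.E ω) (t : G) :
    S.dt t x y ≤ ediam (univ : Set X) := by
  rw [RDS.dt, if_pos h]
  exact iSup₂_le fun ω _ => edist_le_ediam_of_mem (mem_univ _) (mem_univ _)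

/-- For a continuous bundle RDS over a countable amenable group,
the Weyl pseudometric coincides with the Banach pseudometric. -/
theorem weyl_pseudometric_eq_banach_pseudometric
    {G : Type*} [Group G] [Countable G]
    {Ω : Type*} [MeasurableSpace Ω] [MulAction G Ω]
    {μ : Measure Ω} [IsProbabilityMeasure μ]
    {X : Type*} [MetricSpace X] [CompactSpace X] [MeasurableSpace X] [BorelSpace X]
    (hG : ∃ Φ : ℕ → Finset G, IsFolner Φ)
    (S : RDS G Ω μ X) :
    ∀ x y : X, S.DW x y = S.DB x y := by
  intro x y
  refine le_antisymm ?_ (iInf_iSup_sum_div_card_le hG fun t => S.dt t x y)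
  by_cases h : ∃ ω : Ω, x ∈ S.E ω ∧ y ∈ S.E ω
  · exact iSup₂_le fun Φ hΦ => le_iInf₂ fun K hK =>
      limsup_sum_div_card_le isCompact_univ.isBounded.ediam_ne_top
        (fun t => S.dt_le_ediam h t) hΦ hK
  · refine le_iInf₂ fun K hK => le_top.trans (le_iSup_of_le 1 ?_)
    simp [RDS.dt, h, ENNReal.mul_top, ENNReal.top_div, hK.ne_empty]
end

section
/- Let G be a countable amenable group and F a continuous bundle random dynamical system over a measure-preserving dynamical system (Ω,𝓕,ℙ,G) on a compact metric space (X,d). If F is Banach-mean equicontinuous, then F is mean-L-stable: for every ε>0 there is δ>0 such that whenever x,y ∈ 𝓔_ω for some ω ∈ Ω with d(x,y)<δ, the set {g ∈ G : d̃(gx,gy) ≥ ε} has upper Banach density less than ε. -/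
open Filter MeasureTheory Topology Metric Set ENNReal
open scoped symmDiff Classical

/-- Translating a finite set `s` on the left by `k` decreases the number of its
points in `E` by at most the size of the boundary `k s ∆ s`. -/
lemma card_filter_le_card_filter_mul_add {G : Type*} [Group G] (E : Set G) (s : Finset G) (k : G) :
    (s.filter fun g => g ∈ E).card ≤
      (s.filter fun t => k * t ∈ E).card + ((s.image fun t => k * t) ∆ s).card := by
  have hsub : (s.filter fun g => g ∈ E) ⊆
      ((s.filter fun t => k * t ∈ E).image fun t => k * t) ∪ ((s.image fun t => k * t) ∆ s) := by
    intro g hg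
    obtain ⟨hgs, hgE⟩ := Finset.mem_filter.1 hg
    by_cases h : g ∈ s.image fun t => k * t
    · obtain ⟨t, ht, rfl⟩ := Finset.mem_image.1 h
      exact Finset.mem_union_left _
        (Finset.mem_image.2 ⟨t, Finset.mem_filter.2 ⟨ht, hgE⟩, rfl⟩)
    · exact Finset.mem_union_right _ (Finset.mem_symmDiff.2 (Or.inr ⟨hgs, h⟩))
  calc (s.filter fun g => g ∈ E).card
      ≤ _ := Finset.card_le_card hsub
    _ ≤ _ := (Finset.card_union_le _ _).trans (Nat.add_le_add_right Finset.card_image_le _)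

/-- If every right translate of the finite set `K` meets `E` in proportion at most `a`, then a
finite set `s` meets `E` in proportion at most `a`, up to the average boundary of `s` along `K`. -/
lemma card_filter_div_card_le {G : Type*} [Group G] {E : Set G} {K : Finset G} (hK : K.Nonempty)
    {a : ℝ} (h : ∀ g : G, ((K.filter fun k => k * g ∈ E).card : ℝ) ≤ a * K.card)
    {s : Finset G} (hs : s.Nonempty) :
    ((s.filter fun g => g ∈ E).card : ℝ) / s.card ≤
      a + (∑ k ∈ K, (((s.image fun t => k * t) ∆ s).card : ℝ) / s.card) / K.card := by
  have hK0 : (0 : ℝ) < K.card := by exact_mod_cast hK.card_pos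
  have hs0 : (0 : ℝ) < s.card := by exact_mod_cast hs.card_pos
  have hswap : ∑ k ∈ K, ((s.filter fun t => k * t ∈ E).card : ℝ) =
      ∑ t ∈ s, ((K.filter fun k => k * t ∈ E).card : ℝ) := by
    simp only [Finset.card_filter, Nat.cast_sum]
    exact Finset.sum_comm
  have hsum : K.card * ((s.filter fun g => g ∈ E).card : ℝ) ≤
      s.card * (a * K.card) + ∑ k ∈ K, (((s.image fun t => k * t) ∆ s).card : ℝ) := by
    calc K.card * ((s.filter fun g => g ∈ E).card : ℝ)
        = ∑ _k ∈ K, ((s.filter fun g => g ∈ E).card : ℝ) := by simp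
      _ ≤ ∑ k ∈ K, (((s.filter fun t => k * t ∈ E).card : ℝ) +
            (((s.image fun t => k * t) ∆ s).card : ℝ)) :=
          Finset.sum_le_sum fun k _ => by
            exact_mod_cast card_filter_le_card_filter_mul_add E s k
      _ = ∑ t ∈ s, ((K.filter fun k => k * t ∈ E).card : ℝ) +
            ∑ k ∈ K, (((s.image fun t => k * t) ∆ s).card : ℝ) := by
          rw [Finset.sum_add_distrib, hswap]
      _ ≤ _ := by
          gcongr
          simpa using Finset.sum_le_card_nsmul s _ _ fun t _ => h t
  rw [← Finset.sum_div, div_div, ← sub_nonneg]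
  have : a + (∑ k ∈ K, (((s.image fun t => k * t) ∆ s).card : ℝ)) / (s.card * K.card) -
      ((s.filter fun g => g ∈ E).card : ℝ) / s.card =
      (s.card * (a * K.card) + ∑ k ∈ K, (((s.image fun t => k * t) ∆ s).card : ℝ) -
        K.card * ((s.filter fun g => g ∈ E).card : ℝ)) / (s.card * K.card) := by
    field_simp
  rw [this]
  exact div_nonneg (sub_nonneg.2 hsum) (by positivity)

/-- If every right translate of the finite set `K` meets `E` in proportion at most `a`, then the
upper Banach density of `E` is at most `a`. -/
lemma upperBanachDensity_le_of_forall_card_filter_le {G : Type*} [Group G] {E : Set G}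
    {K : Finset G} (hK : K.Nonempty) {a : ℝ}
    (h : ∀ g : G, ((K.filter fun k => k * g ∈ E).card : ℝ) ≤ a * K.card) :
    upperBanachDensity E ≤ ENNReal.ofReal a := by
  refine iSup₂_le fun Φ hΦ => ?_
  have hlim : Tendsto (fun n => ENNReal.ofReal (a +
      (∑ k ∈ K, ((((Φ n).image fun t => k * t) ∆ Φ n).card : ℝ) / (Φ n).card) / K.card))
      atTop (𝓝 (ENNReal.ofReal a)) := by
    refine ENNReal.tendsto_ofReal ?_
    simpa using ((tendsto_finsetSum K fun k _ => hΦ.2 k).div_const (K.card : ℝ)).const_add a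
  rw [← hlim.limsup_eq]
  refine limsup_le_limsup (Eventually.of_forall fun n => ?_)
  have hpos : (0 : ℝ) < (Φ n).card := by exact_mod_cast (hΦ.1 n).card_pos
  refine le_trans (le_of_eq ?_) (ENNReal.ofReal_le_ofReal (card_filter_div_card_le hK h (hΦ.1 n)))
  rw [ENNReal.ofReal_div_of_pos hpos, ENNReal.ofReal_natCast, ENNReal.ofReal_natCast]

/-- A Markov-type inequality: a bound on the Banach pseudometric bounds the upper Banach density
of the set of times at which the two orbits are `ε`-apart. -/
lemma RDS.upperBanachDensity_le_of_DB_lt {G : Type*} [Group G] {Ω : Type*} [MeasurableSpace Ω]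
    [MulAction G Ω] {μ : Measure Ω} {X : Type*} [MetricSpace X] [MeasurableSpace X]
    [BorelSpace X] (S : RDS G Ω μ X) {x y : X} {ε a : ℝ} (hε : 0 < ε) (ha : 0 ≤ a)
    (h : S.DB x y < ENNReal.ofReal (ε * a)) :
    upperBanachDensity {g : G | ENNReal.ofReal ε ≤ S.dt g x y} ≤ ENNReal.ofReal a := by
  simp only [RDS.DB, iInf_lt_iff] at h
  obtain ⟨K, hK, hlt⟩ := h
  refine upperBanachDensity_le_of_forall_card_filter_le hK fun g => ?_
  have hK0 : (K.card : ℝ≥0∞) ≠ 0 := by exact_mod_cast hK.card_pos.ne'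
  have hg : (∑ t ∈ K.image fun k => k * g, S.dt t x y) / (K.card : ℝ≥0∞) ≤
      ENNReal.ofReal (ε * a) :=
    (le_iSup (fun g : G =>
      (∑ t ∈ K.image fun k => k * g, S.dt t x y) / (K.card : ℝ≥0∞)) g).trans hlt.le
  rw [ENNReal.div_le_iff hK0 (ENNReal.natCast_ne_top _),
    Finset.sum_image fun _ _ _ _ hab => mul_right_cancel hab] at hg
  have hmarkov : ENNReal.ofReal
      (((K.filter fun k => k * g ∈ {g : G | ENNReal.ofReal ε ≤ S.dt g x y}).card : ℝ) * ε) ≤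
      ENNReal.ofReal (ε * a * K.card) := by
    calc _ = (K.filter fun k => k * g ∈ {g : G | ENNReal.ofReal ε ≤ S.dt g x y}).card •
            ENNReal.ofReal ε := by
          rw [ENNReal.ofReal_mul (Nat.cast_nonneg _), ENNReal.ofReal_natCast, nsmul_eq_mul]
      _ ≤ ∑ k ∈ K.filter fun k => k * g ∈ {g : G | ENNReal.ofReal ε ≤ S.dt g x y},
            S.dt (k * g) x y :=
          Finset.card_nsmul_le_sum _ _ _ fun k hk => (Finset.mem_filter.1 hk).2
      _ ≤ ∑ k ∈ K, S.dt (k * g) x y := Finset.sum_le_sum_of_subset (Finset.filter_subset _ _)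
      _ ≤ _ := hg
      _ = _ := by
          rw [ENNReal.ofReal_mul (p := ε * a) (by positivity), ENNReal.ofReal_natCast]
  rw [ENNReal.ofReal_le_ofReal_iff (by positivity)] at hmarkov
  rw [mul_assoc, mul_comm] at hmarkov
  have hle := le_of_mul_le_mul_left hmarkov hε
  refine le_trans (le_of_eq ?_) hle
  congr!

/-- A Banach-mean equicontinuous RDS over a countable amenable group
is mean-L-stable. -/
theorem bme_implies_meanLStable
    {G : Type*} [Group G] [Countable G]
    {Ω : Type*} [MeasurableSpace Ω] [MulAction G Ω]
    {μ : Measure Ω} [IsProbabilityMeasure μ]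
    {X : Type*} [MetricSpace X] [CompactSpace X] [MeasurableSpace X] [BorelSpace X]
    (hG : ∃ Φ : ℕ → Finset G, IsFolner Φ)
    (S : RDS G Ω μ X)
    (hBME : S.BME) :
    S.MeanLStable := by
  intro ε hε
  obtain ⟨δ, hδ, hDB⟩ := hBME (ε * (ε / 2)) (by positivity)
  refine ⟨δ, hδ, fun ω x y hx hy hxy => ?_⟩
  refine (S.upperBanachDensity_le_of_DB_lt hε (half_pos hε).le (hDB ω x y hx hy hxy)).trans_lt ?_
  exact (ENNReal.ofReal_lt_ofReal_iff hε).2 (half_lt_self hε)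
end
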